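/- (H¹-norm stability of the weighted time-stepping scheme.) Let 0 < α < 1, ν ∈ [0,1/2), and let the kernels A^{(n,ν)}_{n−k} on a mesh 0 = t_0 < ⋯ < t_N = T satisfy assumptions A1, A2 (with π_A) and A3 (with ρ). On the spatial grid x_i = x_l + i h (0 ≤ i ≤ M, h = (x_r − x_l)/M), let μ : [x_l, x_r] → ℝ satisfy 0 < μ_0 ≤ μ(x) ≤ μ_1, let |c(x_i)| ≤ κ, and let C_Ω > 0 be a constant such that ‖v‖² ≤ C_Ω |v|₁² for all grid functions v vanishing at i = 0 and i = M. Suppose (u^n)_{n=0}^N are grid functions with u^n_0 = u^n_M = 0 satisfying, for all 1 ≤ i ≤ M−1 and 1 ≤ n ≤ N, Σ_{k=1}^n A^{(n,ν)}_{n−k}(u^k_i − u^{k−1}_i) + (L_h u^{n−ν})_i = c(x_i) u^{n−ν}_i + f^{n−ν}_i, where u^{n−ν} := ν u^{n−1} + (1−ν) u^n. If τ := max_k τ_k ≤ (4 π_A Γ(2−α) κ² C_Ω)^{−1/α}, then for all 1 ≤ n ≤ N: |u^n|₁² ≤ 2 E_α(4 π_A max{1,ρ} κ² C_Ω t_n^α)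 ( |u^0|₁² + max_{1≤k≤n} Σ_{j=1}^k P^{(k,ν)}_{k−j} ‖f^{j−ν}‖² ) ≤ 2 E_α(4 π_A max{1,ρ} κ² C_Ω t_n^α) ( |u^0|₁² + π_A Γ(1−α) max_{1≤k≤n} { t_k^α ‖f^{k−ν}‖² } ). -/

import Mathlib

/-- Discrete H¹ seminorm squared: `|v|₁² = h Σ_{i=1}^M μ(x_{i-1/2}) ((v_i - v_{i-1})/h)²`. -/
noncomputable def discH1sq (hs xl : ℝ) (μ : ℝ → ℝ) (M : ℕ) (v : ℕ → ℝ) : ℝ :=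
  hs * ∑ i ∈ Finset.Icc 1 M, μ (xl + ((i:ℝ) - 1/2) * hs) * ((v i - v (i-1)) / hs)^2

/-- Discrete L² norm squared: `‖v‖² = h Σ_{i=1}^{M-1} v_i²`. -/
noncomputable def discL2sq (hs : ℝ) (M : ℕ) (v : ℕ → ℝ) : ℝ :=
  hs * ∑ i ∈ Finset.Icc 1 (M-1), (v i)^2

/-- Discrete elliptic operator `(L_h v)_i`. -/
noncomputable def discLh (hs xl : ℝ) (μ : ℝ → ℝ) (v : ℕ → ℝ) (i : ℕ) : ℝ :=
  -((μ (xl + ((i:ℝ) + 1/2) * hs) * (v (i+1) - v i) / hs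
      - μ (xl + ((i:ℝ) - 1/2) * hs) * (v i - v (i-1)) / hs) / hs)

lemma aux_beta {s t a : ℝ} (hs : 0 < s) (ht : 0 < t) (ha : 0 < a) :
    ∫ x in (0:ℝ)..a, x ^ (s-1) * (a - x) ^ (t-1)
      = a ^ (s+t-1) * (Real.Gamma s * Real.Gamma t / Real.Gamma (s+t)) := by
  have h := Complex.betaIntegral_scaled (s:ℂ) (t:ℂ) ha
  rw [Complex.betaIntegral_eq_Gamma_mul_div _ _ (by simpa) (by simpa)] at h
  have h2 : ∫ x in (0:ℝ)..a, (x : ℂ) ^ ((s:ℂ) - 1) * ((a : ℂ) - x) ^ ((t:ℂ) - 1)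
      = ∫ x in (0:ℝ)..a, ((x ^ (s-1) * (a - x) ^ (t-1) : ℝ) : ℂ) := by
    apply intervalIntegral.integral_congr
    intro x hx
    rw [Set.uIcc_of_le ha.le] at hx
    simp only
    rw [Complex.ofReal_mul, Complex.ofReal_cpow hx.1, Complex.ofReal_cpow (sub_nonneg.2 hx.2)]
    push_cast
    rfl
  rw [h2, intervalIntegral.integral_ofReal] at h
  have h3 : (a:ℂ) ^ ((s:ℂ) + t - 1) = ((a ^ (s+t-1) : ℝ) : ℂ) := by
    rw [Complex.ofReal_cpow ha.le]; push_cast; rfl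
  rw [h3, ← Complex.ofReal_add, Complex.Gamma_ofReal, Complex.Gamma_ofReal, Complex.Gamma_ofReal] at h
  exact_mod_cast h

lemma aux_beta_int {s t a : ℝ} (hs : 0 < s) (ht : 0 < t) (ha : 0 < a) :
    IntervalIntegrable (fun x : ℝ => x ^ (s-1) * (a - x) ^ (t-1)) MeasureTheory.volume 0 a := by
  apply intervalIntegral.intervalIntegrable_of_integral_ne_zero
  rw [aux_beta hs ht ha]
  have := Real.Gamma_pos_of_pos hs
  have := Real.Gamma_pos_of_pos ht
  have := Real.Gamma_pos_of_pos (add_pos hs ht)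
  positivity

lemma aux_ML {α : ℝ} (h0 : 0 < α) (h1 : α < 1) {x : ℝ} (hx : 0 < x) :
    Summable (fun i : ℕ => x ^ i / Real.Gamma (1 + (i:ℝ) * α)) := by
  have hG : ∀ i : ℕ, 0 < Real.Gamma (1 + (i:ℝ) * α) := fun i =>
    Real.Gamma_pos_of_pos (by positivity)
  have key : ∀ i : ℕ, (((i:ℝ)+1) * α) ^ α * Real.Gamma (1 + (i:ℝ) * α) ≤
      Real.Gamma (1 + ((i+1 : ℕ):ℝ) * α) := by
    intro i
    set y : ℝ := ((i:ℝ)+1) * α with hy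
    have hy0 : 0 < y := by positivity
    have h := Real.Gamma_mul_add_mul_le_rpow_Gamma_mul_rpow_Gamma (s := y) (t := y + 1)
      (a := α) (b := 1 - α) hy0 (by positivity) h0 (by linarith) (by ring)
    have e1 : α * y + (1-α) * (y+1) = 1 + (i:ℝ) * α := by rw [hy]; ring
    have e2 : 1 + ((i+1 : ℕ):ℝ) * α = y + 1 := by rw [hy]; push_cast; ring
    rw [e1] at h
    rw [e2]
    have hgy := Real.Gamma_pos_of_pos hy0
    have hg1 : Real.Gamma (y+1) = y * Real.Gamma y := Real.Gamma_add_one hy0.ne'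
    calc y ^ α * Real.Gamma (1 + (i:ℝ) * α) ≤ y ^ α * (Real.Gamma y ^ α * Real.Gamma (y+1) ^ (1-α)) := by
          gcongr
      _ = (y * Real.Gamma y) ^ α * Real.Gamma (y+1) ^ (1-α) := by
          rw [Real.mul_rpow hy0.le hgy.le]; ring
      _ = Real.Gamma (y+1) := by
          rw [← hg1, ← Real.rpow_add (by rw [hg1]; positivity)]; simp
  refine summable_of_ratio_test_tendsto_lt_one (l := 0) zero_lt_one
    (Filter.Eventually.of_forall fun i => (div_pos (pow_pos hx i) (hG i)).ne') ?_
  have hlim : Filter.Tendsto (fun i : ℕ => x / (((i:ℝ)+1) * α) ^ α) Filter.atTop (nhds 0) := by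
    apply Filter.Tendsto.const_div_atTop
    apply (tendsto_rpow_atTop h0).comp
    apply Filter.Tendsto.atTop_mul_const h0
    exact Filter.tendsto_atTop_add_const_right _ _ tendsto_natCast_atTop_atTop
  refine squeeze_zero (fun i => by positivity) (fun i => ?_) hlim
  have p1 : 0 < x ^ (i+1) / Real.Gamma (1 + ((i+1:ℕ):ℝ) * α) := div_pos (pow_pos hx _) (hG _)
  have p2 : 0 < x ^ i / Real.Gamma (1 + (i:ℝ) * α) := div_pos (pow_pos hx _) (hG _)
  rw [Real.norm_of_nonneg p1.le, Real.norm_of_nonneg p2.le]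
  have hp : 0 < (((i:ℝ)+1) * α) ^ α := by positivity
  have k := key i
  have g1 := hG i
  have g2 := hG (i+1)
  rw [div_div_div_eq, div_le_div_iff₀ (by positivity) hp]
  calc _ = x ^ (i+1) * ((((i:ℝ)+1) * α) ^ α * Real.Gamma (1 + (i:ℝ) * α)) := by ring
    _ ≤ x ^ (i+1) * Real.Gamma (1 + ((i+1 : ℕ):ℝ) * α) := by gcongr
    _ = _ := by ring

/-- integrability of the kernel -/
lemma aux_om_int {α r a b : ℝ} (h1 : α < 1) :
    IntervalIntegrable (fun s : ℝ => (r - s) ^ (-α)) MeasureTheory.volume a b := by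
  have := (intervalIntegral.intervalIntegrable_rpow' (a := r - a) (b := r - b) (r := -α) (by linarith))
  simpa using this.comp_sub_left r

/-- convex case -/
lemma aux_convex {α β r a b d : ℝ} (h1 : α < 1) (hβ : 1 ≤ β) (ha : 0 ≤ a) (hab : a < b)
    (hbr : b ≤ r) (hbd : b < d)
    (hi : IntervalIntegrable (fun x : ℝ => x ^ (β-1) * (r - x) ^ (-α)) MeasureTheory.volume a b) :
    ∫ x in a..b, x ^ (β-1) * (r - x) ^ (-α)
      ≤ (∫ x in a..b, (r - x) ^ (-α)) * ((∫ x in b..d, x ^ (β-1)) / (d - b)) := by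
  have e1 : ∫ x in a..b, x ^ (β-1) * (r - x) ^ (-α) ≤ ∫ x in a..b, b ^ (β-1) * (r - x) ^ (-α) := by
    apply intervalIntegral.integral_mono_on hab.le hi ((aux_om_int h1).const_mul _)
    intro x hx
    have : 0 ≤ r - x := by linarith [hx.2]
    apply mul_le_mul_of_nonneg_right _ (by positivity)
    exact Real.rpow_le_rpow (ha.trans hx.1) hx.2 (by linarith)
  have e2 : ∫ x in b..d, b ^ (β-1) ≤ ∫ x in b..d, x ^ (β-1) := by
    apply intervalIntegral.integral_mono_on hbd.le (by simp)
      (intervalIntegral.intervalIntegrable_rpow' (by linarith))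
    intro x hx
    exact Real.rpow_le_rpow (by linarith) hx.1 (by linarith)
  have e3 : 0 ≤ ∫ x in a..b, (r - x) ^ (-α) := by
    apply intervalIntegral.integral_nonneg hab.le
    intro x hx
    have : 0 ≤ r - x := by linarith [hx.2]
    positivity
  rw [intervalIntegral.integral_const_mul, mul_comm] at e1
  refine e1.trans (mul_le_mul_of_nonneg_left ?_ e3)
  rw [intervalIntegral.integral_const, smul_eq_mul] at e2
  rw [le_div_iff₀ (by linarith)]
  linarith

/-- concave case : Chebyshev -/
lemma aux_concave {α β r a b : ℝ} (h0 : 0 < α) (h1 : α < 1) (hβ0 : 0 < β) (hβ : β ≤ 1) (ha : 0 ≤ a)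
    (hab : a < b) (hbr : b ≤ r)
    (hi : IntervalIntegrable (fun x : ℝ => x ^ (β-1) * (r - x) ^ (-α)) MeasureTheory.volume a b) :
    ∫ x in a..b, x ^ (β-1) * (r - x) ^ (-α)
      ≤ (∫ x in a..b, (r - x) ^ (-α)) / (b - a) * (∫ x in a..b, x ^ (β-1)) := by
  set m : ℝ := (∫ x in a..b, (r - x) ^ (-α)) / (b - a) with hm
  have hra : 0 < r - a := by linarith
  have hma : (r - a) ^ (-α) < m := by
    rw [hm, lt_div_iff₀ (by linarith)]
    have : 0 < ∫ x in a..b, ((r - x) ^ (-α) - (r - a) ^ (-α)) := by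
      apply intervalIntegral.intervalIntegral_pos_of_pos_on ((aux_om_int h1).sub (by simp)) _ hab
      intro x hx
      have := Real.rpow_lt_rpow_of_neg (x := r - x) (y := r - a) (z := -α) (by linarith [hx.2])
        (by linarith [hx.1]) (by linarith)
      linarith
    rw [intervalIntegral.integral_sub (aux_om_int h1) (by simp), intervalIntegral.integral_const,
      smul_eq_mul] at this
    linarith
  have hm0 : 0 < m := lt_trans (by positivity) hma
  set e : ℝ := m ^ (-α)⁻¹ with he
  have he0 : 0 < e := by positivity
  have hem : e ^ (-α) = m := by
    rw [he, ← Real.rpow_mul hm0.le, inv_mul_cancel₀ (by linarith), Real.rpow_one]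
  have hea : e < r - a := by
    by_contra hcon
    push Not at hcon
    have := Real.rpow_le_rpow_of_nonpos hra hcon (z := -α) (by linarith)
    linarith
  set c := r - e with hc
  have hc0 : 0 < c := by linarith
  have hg : IntervalIntegrable (fun x : ℝ => x ^ (β-1)) MeasureTheory.volume a b :=
    intervalIntegral.intervalIntegrable_rpow' (by linarith)
  have hle : ∫ x in a..b, (x ^ (β-1) * (r - x) ^ (-α) + m * c ^ (β-1)) ≤
      ∫ x in a..b, (m * x ^ (β-1) + c ^ (β-1) * (r - x) ^ (-α)) := by
    apply intervalIntegral.integral_mono_on_of_le_Ioo hab.le (hi.add (by simp))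
      ((hg.const_mul _).add ((aux_om_int h1).const_mul _))
    intro x hx
    have hx0 : 0 < x := by linarith [hx.1]
    have hxr : 0 < r - x := by linarith [hx.2]
    rcases le_total x c with h | h
    · have i1 : c ^ (β-1) ≤ x ^ (β-1) := Real.rpow_le_rpow_of_nonpos hx0 h (by linarith)
      have i2 : (r - x) ^ (-α) ≤ m := by
        rw [← hem]; exact Real.rpow_le_rpow_of_nonpos he0 (by linarith) (by linarith)
      nlinarith
    · have i1 : x ^ (β-1) ≤ c ^ (β-1) := Real.rpow_le_rpow_of_nonpos hc0 h (by linarith)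
      have i2 : m ≤ (r - x) ^ (-α) := by
        rw [← hem]; exact Real.rpow_le_rpow_of_nonpos hxr (by linarith) (by linarith)
      nlinarith
  rw [intervalIntegral.integral_add hi (by simp), intervalIntegral.integral_add (hg.const_mul _)
    ((aux_om_int h1).const_mul _)] at hle
  simp only [intervalIntegral.integral_const_mul, intervalIntegral.integral_const,
    smul_eq_mul] at hle
  have hmm : ∫ x in a..b, (r - x) ^ (-α) = m * (b - a) := by
    rw [hm]; field_simp [show b - a ≠ 0 by linarith]
  rw [hmm] at hle
  linarith

lemma aux_tel (G : ℕ → ℝ) (p : ℕ) : ∑ k ∈ Finset.Icc 1 p, (G k - G (k-1)) = G p - G 0 := by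
  induction p with
  | zero => simp
  | succ p ih => rw [Finset.sum_Icc_succ_top (by omega), ih]; simp

lemma aux_tel2 (G : ℕ → ℝ) (p : ℕ) : ∑ k ∈ Finset.Icc 1 p, (G (k+1) - G k) = G (p+1) - G 1 := by
  induction p with
  | zero => simp
  | succ p ih => rw [Finset.sum_Icc_succ_top (by omega), ih]; simp

lemma aux_ident (n : ℕ) (a : ℕ → ℕ → ℝ) (q : ℕ → ℝ)
    (hqn : q n * a n n = 1)
    (hq : ∀ j, 1 ≤ j → j + 1 ≤ n → a j j * q j = ∑ k ∈ Finset.Icc (j+1) n, (a k (j+1) - a k j) * q k)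
    (d : ℕ) : ∀ k, 1 ≤ k → k + d = n → ∑ j ∈ Finset.Icc k n, q j * a j k = 1 := by
  induction d with
  | zero => intro k _ h; obtain rfl : k = n := by omega
            simpa using hqn
  | succ d ih =>
    intro k hk h
    rw [← Finset.add_sum_Ioc_eq_sum_Icc (by omega), ← Finset.Icc_add_one_left_eq_Ioc, mul_comm,
      hq k hk (by omega), ← Finset.sum_add_distrib, ← ih (k+1) (by omega) (by omega)]
    apply Finset.sum_congr rfl
    intros; ring

lemma aux_qnonneg (n : ℕ) (a : ℕ → ℕ → ℝ) (q : ℕ → ℝ)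
    (hqn : q n * a n n = 1) (ha : ∀ j, 1 ≤ j → j ≤ n → 0 < a j j)
    (ham : ∀ k j, 1 ≤ j → j + 1 ≤ k → k ≤ n → a k j ≤ a k (j+1))
    (hq : ∀ j, 1 ≤ j → j + 1 ≤ n → a j j * q j = ∑ k ∈ Finset.Icc (j+1) n, (a k (j+1) - a k j) * q k)
    (d : ℕ) : ∀ k, 1 ≤ k → k ≤ n → n ≤ k + d → 0 ≤ q k := by
  induction d with
  | zero => intro k h1 h2 h; obtain rfl : k = n := by omega
            have := ha k h1 h2
            by_contra hc
            push Not at hc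
            nlinarith
  | succ d ih =>
    intro k h1 h2 h
    by_cases h3 : n ≤ k + d
    · exact ih k h1 h2 h3
    have := hq k h1 (by omega)
    have h4 : 0 ≤ a k k * q k := by
      rw [this]
      apply Finset.sum_nonneg
      intro j hj
      rw [Finset.mem_Icc] at hj
      exact mul_nonneg (sub_nonneg.2 (ham j k h1 hj.1 hj.2)) (ih j (by omega) hj.2 (by omega))
    have := ha k h1 h2
    by_contra hc
    push Not at hc
    nlinarith

lemma aux_sum (n : ℕ) (a : ℕ → ℕ → ℝ) (q : ℕ → ℝ)
    (hid : ∀ k, 1 ≤ k → k ≤ n → ∑ j ∈ Finset.Icc k n, q j * a j k = 1) (F : ℕ → ℝ) :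
    ∑ j ∈ Finset.Icc 1 n, q j * ∑ k ∈ Finset.Icc 1 j, a j k * F k = ∑ k ∈ Finset.Icc 1 n, F k := by
  simp_rw [Finset.mul_sum]
  rw [Finset.sum_comm' (t' := Finset.Icc 1 n) (s' := fun k => Finset.Icc k n)]
  · apply Finset.sum_congr rfl
    intro k hk
    rw [Finset.mem_Icc] at hk
    simp_rw [← mul_assoc]
    rw [← Finset.sum_mul, hid k hk.1 hk.2, one_mul]
  · intro x y
    simp only [Finset.mem_Icc]
    omega

lemma aux_sum_lt (n : ℕ) (hn : 1 ≤ n) (a : ℕ → ℕ → ℝ) (q : ℕ → ℝ)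
    (hid : ∀ k, 1 ≤ k → k ≤ n → ∑ j ∈ Finset.Icc k n, q j * a j k = 1)
    (hq : 0 ≤ q n) (ha : ∀ k, 1 ≤ k → k ≤ n → 0 ≤ a n k)
    (F : ℕ → ℝ) (hF : ∀ k, 1 ≤ k → k ≤ n - 1 → 0 ≤ F k) :
    ∑ j ∈ Finset.Icc 1 (n-1), q j * ∑ k ∈ Finset.Icc 1 j, a j k * F k
      ≤ ∑ k ∈ Finset.Icc 1 (n-1), F k := by
  obtain ⟨p, rfl⟩ : ∃ p, n = p + 1 := ⟨n-1, by omega⟩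
  simp only [Nat.add_sub_cancel] at *
  have h := aux_sum (p+1) a q hid (fun k => if k ≤ p then F k else 0)
  have hL : ∀ G : ℕ → ℝ, ∑ k ∈ Finset.Icc 1 (p+1), G k = ∑ k ∈ Finset.Icc 1 p, G k + G (p+1) :=
    fun G => Finset.sum_Icc_succ_top (by omega) G
  rw [hL (fun k => if k ≤ p then F k else 0), hL] at h
  have e1 : ∑ k ∈ Finset.Icc 1 p, (if k ≤ p then F k else 0) = ∑ k ∈ Finset.Icc 1 p, F k := by
    apply Finset.sum_congr rfl
    intro k hk
    rw [Finset.mem_Icc] at hk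
    simp [hk.2]
  have e2 : ∑ j ∈ Finset.Icc 1 p, q j * ∑ k ∈ Finset.Icc 1 j, a j k * (if k ≤ p then F k else 0)
      = ∑ j ∈ Finset.Icc 1 p, q j * ∑ k ∈ Finset.Icc 1 j, a j k * F k := by
    apply Finset.sum_congr rfl
    intro j hj
    congr 1
    apply Finset.sum_congr rfl
    intro k hk
    rw [Finset.mem_Icc] at hk hj
    simp [hk.2.trans hj.2]
  have e3 : 0 ≤ q (p+1) * ∑ k ∈ Finset.Icc 1 (p+1), a (p+1) k * (if k ≤ p then F k else 0) := by
    apply mul_nonneg hq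
    apply Finset.sum_nonneg
    intro k hk
    rw [Finset.mem_Icc] at hk
    apply mul_nonneg (ha k hk.1 hk.2)
    split_ifs with hkp
    · exact hF k hk.1 hkp
    · exact le_rfl
  rw [e1, e2] at h
  have e4 : (if p + 1 ≤ p then F (p+1) else 0) = 0 := if_neg (by omega)
  rw [e4] at h
  linarith

lemma aux_F (α β πA ρ : ℝ) (h0 : 0 < α) (h1 : α < 1) (hβ0 : 0 < β) (hπA : 0 < πA) (n : ℕ) (hn : 1 ≤ n)
    (t : ℕ → ℝ) (ht0 : t 0 = 0) (htmono : ∀ k : ℕ, 1 ≤ k → k ≤ n → t (k-1) < t k)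
    (hpos : ∀ k ≤ n, 0 ≤ t k) (hle : ∀ j k, j ≤ k → k ≤ n → t j ≤ t k)
    (a : ℕ → ℕ → ℝ)
    (hA2 : ∀ n' k : ℕ, 1 ≤ k → k ≤ n' → n' ≤ n →
      (1 / (πA * (t k - t (k-1)))) *
        ∫ s in (t (k-1))..(t k), (t n' - s) ^ (-α) / Real.Gamma (1-α) ≤ a n' k)
    (hA3 : ∀ k : ℕ, 1 ≤ k → k ≤ n - 1 → (t k - t (k-1)) / (t (k+1) - t k) ≤ ρ) :
    ∃ F : ℕ → ℝ, (∀ k, 1 ≤ k → k ≤ n - 1 → 0 ≤ F k) ∧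
      ∑ k ∈ Finset.Icc 1 (n-1), F k ≤ max 1 ρ * (t n ^ β / β) ∧
      ∀ j k, 1 ≤ k → k ≤ j → j ≤ n - 1 →
        ∫ x in (t (k-1))..(t k), x ^ (β-1) * (t j - x) ^ (-α)
          ≤ πA * Real.Gamma (1-α) * (a j k * F k) := by
  have hG : 0 < Real.Gamma (1-α) := Real.Gamma_pos_of_pos (by linarith)
  have hmax : 1 ≤ max 1 ρ := le_max_left _ _
  have hint : ∀ c d : ℝ, ∫ x in c..d, x ^ (β-1) = d ^ β / β - c ^ β / β := by
    intro c d
    rw [integral_rpow (Or.inl (by linarith))]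
    simp [sub_div]
  have hi : ∀ j k, 1 ≤ k → k ≤ j → j ≤ n - 1 →
     IntervalIntegrable (fun x : ℝ => x ^ (β-1) * (t j - x) ^ (-α)) MeasureTheory.volume (t (k-1)) (t k) := by
    intro j k hk hkj hj
    have hk' := htmono k hk (by omega)
    have hkp := hpos (k-1) (by omega)
    have hkj' := hle k j hkj (by omega)
    have := aux_beta_int (s := β) (t := 1-α) (a := t j) hβ0 (by linarith) (by linarith)
    rw [show (1-α-1) = -α by ring] at this
    apply this.mono_set
    rw [Set.uIcc_of_le hk'.le, Set.uIcc_of_le (by linarith : (0:ℝ) ≤ t j)]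
    exact Set.Icc_subset_Icc hkp hkj'
  have hA2' : ∀ j k, 1 ≤ k → k ≤ j → j ≤ n - 1 →
      (∫ s in (t (k-1))..(t k), (t j - s) ^ (-α)) / (t k - t (k-1)) ≤ πA * Real.Gamma (1-α) * a j k := by
    intro j k hk hkj hj
    have h := hA2 j k hk hkj (by omega)
    have hk' := htmono k hk (by omega)
    rw [intervalIntegral.integral_div] at h
    have hd : 0 < t k - t (k-1) := by linarith
    calc _ = πA * Real.Gamma (1-α) * (1 / (πA * (t k - t (k-1))) *
          ((∫ s in (t (k-1))..(t k), (t j - s) ^ (-α)) / Real.Gamma (1-α))) := by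
          field_simp
      _ ≤ _ := by gcongr
  rcases le_total β 1 with hβ | hβ
  · refine ⟨fun k => t k ^ β / β - t (k-1) ^ β / β, ?_, ?_, ?_⟩
    · intro k hk hkn
      have := Real.rpow_le_rpow (hpos (k-1) (by omega)) (hle (k-1) k (by omega) (by omega)) hβ0.le
      have := div_le_div_of_nonneg_right this hβ0.le
      simp only; linarith
    · rw [aux_tel (fun k => t k ^ β / β)]
      simp only [ht0, Real.zero_rpow hβ0.ne', zero_div, sub_zero]
      have := Real.rpow_le_rpow (hpos (n-1) (by omega)) (hle (n-1) n (by omega) (by omega)) hβ0.le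
      have := div_le_div_of_nonneg_right this hβ0.le
      have h2 : 0 ≤ t n ^ β / β := div_nonneg (Real.rpow_nonneg (hpos n le_rfl) _) hβ0.le
      nlinarith
    · intro j k hk hkj hj
      have hk' := htmono k hk (by omega)
      have h := aux_concave h0 h1 hβ0 hβ (hpos (k-1) (by omega)) hk' (hle k j hkj (by omega))
        (hi j k hk hkj hj)
      rw [hint] at h
      refine h.trans ?_
      rw [← mul_assoc]
      apply mul_le_mul_of_nonneg_right (hA2' j k hk hkj hj)
      have := Real.rpow_le_rpow (hpos (k-1) (by omega)) hk'.le hβ0.le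
      have := div_le_div_of_nonneg_right this hβ0.le
      linarith
  · have hnn : ∀ k, 1 ≤ k → k ≤ n - 1 → 0 ≤ t (k+1) ^ β / β - t k ^ β / β := by
      intro k hk hkn
      have := Real.rpow_le_rpow (hpos k (by omega)) (hle k (k+1) (by omega) (by omega)) hβ0.le
      have := div_le_div_of_nonneg_right this hβ0.le
      linarith
    refine ⟨fun k => max 1 ρ * (t (k+1) ^ β / β - t k ^ β / β), ?_, ?_, ?_⟩
    · intro k hk hkn
      exact mul_nonneg (by linarith) (hnn k hk hkn)
    · rw [← Finset.mul_sum, aux_tel2 (fun k => t k ^ β / β), Nat.sub_add_cancel hn]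
      apply mul_le_mul_of_nonneg_left _ (by linarith)
      have h2 : 0 ≤ t 1 ^ β / β := div_nonneg (Real.rpow_nonneg (hpos 1 hn) _) hβ0.le
      linarith
    · intro j k hk hkj hj
      have hk' := htmono k hk (by omega)
      have hk'' := htmono (k+1) (by omega) (by omega)
      simp only [Nat.add_sub_cancel] at hk''
      have h := aux_convex h1 hβ (hpos (k-1) (by omega)) hk' (hle k j hkj (by omega)) hk''
        (hi j k hk hkj hj)
      rw [hint] at h
      have hA := hA2' j k hk hkj hj
      have hr := hA3 k hk (by omega)
      set I := ∫ s in (t (k-1))..(t k), (t j - s) ^ (-α) with hI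
      set D := t (k+1) ^ β / β - t k ^ β / β with hD
      have hD0 : 0 ≤ D := hnn k hk (by omega)
      have hd1 : 0 < t k - t (k-1) := by linarith
      have hd2 : 0 < t (k+1) - t k := by linarith
      have hI0 : 0 ≤ I := by
        apply intervalIntegral.integral_nonneg hk'.le
        intro x hx
        have := hle k j hkj (by omega)
        have : 0 ≤ t j - x := by linarith [hx.2]
        positivity
      calc _ ≤ I * (D / (t (k+1) - t k)) := h
        _ = I / (t k - t (k-1)) * (((t k - t (k-1)) / (t (k+1) - t k)) * D) := by field_simp
        _ ≤ (πA * Real.Gamma (1-α) * a j k) * (max 1 ρ * D) := by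
          apply mul_le_mul hA
          · exact mul_le_mul_of_nonneg_right (hr.trans (le_max_right _ _)) hD0
          · positivity
          · exact le_trans (by positivity) hA
        _ = _ := by ring

lemma aux_term (α πA ρ : ℝ) (h0 : 0 < α) (h1 : α < 1) (hπA : 0 < πA) (n : ℕ) (hn : 1 ≤ n)
    (t : ℕ → ℝ) (ht0 : t 0 = 0) (htmono : ∀ k : ℕ, 1 ≤ k → k ≤ n → t (k-1) < t k)
    (hpos : ∀ k ≤ n, 0 ≤ t k) (hle : ∀ j k, j ≤ k → k ≤ n → t j ≤ t k)
    (a : ℕ → ℕ → ℝ) (q : ℕ → ℝ)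
    (hA2 : ∀ n' k : ℕ, 1 ≤ k → k ≤ n' → n' ≤ n →
      (1 / (πA * (t k - t (k-1)))) *
        ∫ s in (t (k-1))..(t k), (t n' - s) ^ (-α) / Real.Gamma (1-α) ≤ a n' k)
    (hA3 : ∀ k : ℕ, 1 ≤ k → k ≤ n - 1 → (t k - t (k-1)) / (t (k+1) - t k) ≤ ρ)
    (hid : ∀ k, 1 ≤ k → k ≤ n → ∑ j ∈ Finset.Icc k n, q j * a j k = 1)
    (hq : ∀ k, 1 ≤ k → k ≤ n → 0 ≤ q k) (ha : ∀ k, 1 ≤ k → k ≤ n → 0 ≤ a n k) (m : ℕ) :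
    ∑ j ∈ Finset.Icc 1 (n-1), q j * ((t j ^ α) ^ m / Real.Gamma (1 + (m:ℝ) * α))
      ≤ πA * max 1 ρ * ((t n ^ α) ^ (m+1) / Real.Gamma (1 + ((m+1:ℕ):ℝ) * α)) := by
  set β : ℝ := ((m:ℝ)+1) * α with hβ
  have hβ0 : 0 < β := by positivity
  have hG : 0 < Real.Gamma (1-α) := Real.Gamma_pos_of_pos (by linarith)
  have hGβ : 0 < Real.Gamma β := Real.Gamma_pos_of_pos hβ0
  obtain ⟨F, hF0, hFs, hFJ⟩ := aux_F α β πA ρ h0 h1 hβ0 hπA n hn t ht0 htmono hpos hle a hA2 hA3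
  have hj : ∀ j ∈ Finset.Icc 1 (n-1), q j * ((t j ^ α) ^ m / Real.Gamma (1 + (m:ℝ) * α)) ≤
      πA / Real.Gamma β * (q j * ∑ k ∈ Finset.Icc 1 j, a j k * F k) := by
    intro j hj
    rw [Finset.mem_Icc] at hj
    have htj : 0 < t j := by
      have := htmono j hj.1 (by omega)
      have := hpos (j-1) (by omega)
      linarith
    have hb := aux_beta (s := β) (t := 1-α) hβ0 (by linarith) htj
    have hbi := aux_beta_int (s := β) (t := 1-α) hβ0 (by linarith) htj
    rw [show (1-α-1) = -α by ring] at hb hbi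
    rw [show β + (1-α) - 1 = α * m by rw [hβ]; ring, show β + (1-α) = 1 + (m:ℝ) * α by rw [hβ]; ring,
      Real.rpow_mul htj.le, Real.rpow_natCast] at hb
    have hG1 : 0 < Real.Gamma (1 + (m:ℝ) * α) := Real.Gamma_pos_of_pos (by positivity)
    have hsum : ∑ k ∈ Finset.Icc 1 j, ∫ x in (t (k-1))..(t k), x ^ (β-1) * (t j - x) ^ (-α) =
        ∫ x in (0:ℝ)..(t j), x ^ (β-1) * (t j - x) ^ (-α) := by
      have hsub : ∀ k, k ≤ j → IntervalIntegrable (fun x : ℝ => x ^ (β-1) * (t j - x) ^ (-α))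
          MeasureTheory.volume 0 (t k) := by
        intro k hk
        apply hbi.mono_set
        rw [Set.uIcc_of_le htj.le, Set.uIcc_of_le (hpos k (by omega))]
        exact Set.Icc_subset_Icc le_rfl (hle k j hk (by omega))
      have := aux_tel (fun k => ∫ x in (0:ℝ)..(t k), x ^ (β-1) * (t j - x) ^ (-α)) j
      simp only [ht0, intervalIntegral.integral_same, sub_zero] at this
      rw [← this]
      apply Finset.sum_congr rfl
      intro k hk
      rw [Finset.mem_Icc] at hk
      rw [intervalIntegral.integral_interval_sub_left (hsub k hk.2) (hsub (k-1) (by omega))]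
    have hle2 : ∫ x in (0:ℝ)..(t j), x ^ (β-1) * (t j - x) ^ (-α) ≤
        πA * Real.Gamma (1-α) * ∑ k ∈ Finset.Icc 1 j, a j k * F k := by
      rw [← hsum, Finset.mul_sum]
      apply Finset.sum_le_sum
      intro k hk
      rw [Finset.mem_Icc] at hk
      exact hFJ j k hk.1 hk.2 hj.2
    rw [hb] at hle2
    have : (t j ^ α) ^ m / Real.Gamma (1 + (m:ℝ) * α) ≤
        πA / Real.Gamma β * ∑ k ∈ Finset.Icc 1 j, a j k * F k := by
      have h3 := mul_le_mul_of_nonneg_left hle2 (by positivity : 0 ≤ 1 / (Real.Gamma β * Real.Gamma (1-α)))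
      calc _ = 1 / (Real.Gamma β * Real.Gamma (1-α)) * ((t j ^ α) ^ m * (Real.Gamma β * Real.Gamma (1-α) / Real.Gamma (1 + (m:ℝ) * α))) := by
            field_simp
        _ ≤ _ := h3
        _ = _ := by field_simp
    calc _ ≤ q j * (πA / Real.Gamma β * ∑ k ∈ Finset.Icc 1 j, a j k * F k) :=
          mul_le_mul_of_nonneg_left this (hq j hj.1 (by omega))
      _ = _ := by ring
  refine (Finset.sum_le_sum hj).trans ?_
  rw [← Finset.mul_sum]
  have h4 := (aux_sum_lt n hn a q hid (hq n hn le_rfl) ha F hF0).trans hFs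
  refine (mul_le_mul_of_nonneg_left h4 (by positivity)).trans (le_of_eq ?_)
  have e : 1 + ((m+1:ℕ):ℝ) * α = β + 1 := by rw [hβ]; push_cast; ring
  rw [e, Real.Gamma_add_one hβ0.ne', show β = α * ((m+1:ℕ):ℝ) by rw [hβ]; push_cast; ring,
    Real.rpow_mul (hpos n le_rfl), Real.rpow_natCast]
  field_simp

lemma aux_W (α πA ρ lam : ℝ) (h0 : 0 < α) (h1 : α < 1) (hπA : 0 < πA) (hlam : 0 < lam) (n : ℕ) (hn : 1 ≤ n)
    (t : ℕ → ℝ) (hpos : ∀ k, 1 ≤ k → k ≤ n → 0 < t k) (q : ℕ → ℝ)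
    (hterm : ∀ m : ℕ, ∑ j ∈ Finset.Icc 1 (n-1), q j * ((t j ^ α) ^ m / Real.Gamma (1 + (m:ℝ) * α))
      ≤ πA * max 1 ρ * ((t n ^ α) ^ (m+1) / Real.Gamma (1 + ((m+1:ℕ):ℝ) * α))) :
    4 * lam * ∑ j ∈ Finset.Icc 1 (n-1), q j *
      (∑' i : ℕ, (4 * πA * max 1 ρ * lam * t j ^ α) ^ i / Real.Gamma (1 + (i:ℝ) * α))
      ≤ (∑' i : ℕ, (4 * πA * max 1 ρ * lam * t n ^ α) ^ i / Real.Gamma (1 + (i:ℝ) * α)) - 1 := by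
  have hmax : 0 < max 1 ρ := lt_of_lt_of_le one_pos (le_max_left _ _)
  have hS : ∀ k, 1 ≤ k → k ≤ n → Summable (fun i : ℕ =>
      (4 * πA * max 1 ρ * lam * t k ^ α) ^ i / Real.Gamma (1 + (i:ℝ) * α)) := by
    intro k hk hkn
    have := hpos k hk hkn
    exact aux_ML h0 h1 (by positivity)
  have hSn := hS n hn le_rfl
  rw [hSn.tsum_eq_zero_add]
  simp only [pow_zero, Nat.cast_zero, zero_mul, add_zero, Real.Gamma_one, div_one, add_sub_cancel_left]
  rw [Finset.mul_sum]
  simp_rw [← tsum_mul_left]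
  have hS' : ∀ j ∈ Finset.Icc 1 (n-1), Summable (fun i : ℕ =>
      4 * lam * (q j * ((4 * πA * max 1 ρ * lam * t j ^ α) ^ i / Real.Gamma (1 + (i:ℝ) * α)))) := by
    intro j hj
    rw [Finset.mem_Icc] at hj
    exact ((hS j hj.1 (by omega)).mul_left _).mul_left _
  rw [← Summable.tsum_finsetSum hS']
  apply Summable.tsum_le_tsum _ (summable_sum hS') ((summable_nat_add_iff 1).2 hSn)
  intro m
  have h := hterm m
  set c := 4 * πA * max 1 ρ * lam with hc
  have hc0 : 0 < c := by positivity
  calc _ = 4 * lam * c ^ m * ∑ j ∈ Finset.Icc 1 (n-1), q j * ((t j ^ α) ^ m / Real.Gamma (1 + (m:ℝ) * α)) := by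
        rw [Finset.mul_sum]
        apply Finset.sum_congr rfl
        intro j _
        rw [mul_pow]; ring
    _ ≤ 4 * lam * c ^ m * (πA * max 1 ρ * ((t n ^ α) ^ (m+1) / Real.Gamma (1 + ((m+1:ℕ):ℝ) * α))) := by
        gcongr
    _ = _ := by rw [hc]; ring

lemma aux_abel (n : ℕ) (b e : ℕ → ℝ) (hb1 : 0 ≤ b 1) (hbm : ∀ k, 1 ≤ k → k + 1 ≤ n → b k ≤ b (k+1))
    (he : ∀ k, 0 ≤ e k) (p : ℕ) (hp : 1 ≤ p) (hpn : p ≤ n) :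
    - (b p * e p) ≤ ∑ k ∈ Finset.Icc 1 p, b k * (e (k-1) - e k) := by
  induction p, hp using Nat.le_induction with
  | base => simp; nlinarith [mul_nonneg hb1 (he 0)]
  | succ p hp ih =>
    rw [Finset.sum_Icc_succ_top (by omega)]
    have := ih (by omega)
    have h2 := mul_nonneg (sub_nonneg.2 (hbm p hp hpn)) (he p)
    simp only [Nat.add_sub_cancel]
    nlinarith

lemma aux_energy (n : ℕ) (hn : 1 ≤ n) (ν : ℝ) (hν0 : 0 ≤ ν) (hν1 : ν < 1/2) (b x : ℕ → ℝ)
    (hb1 : 0 ≤ b 1) (hbm : ∀ k, 1 ≤ k → k + 1 ≤ n → b k ≤ b (k+1))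
    (hb2 : 2 ≤ n → 0 ≤ (1-2*ν) * b n - (1-ν) * b (n-1)) :
    ∑ k ∈ Finset.Icc 1 n, b k * (x k ^ 2 - x (k-1) ^ 2) ≤
      2 * (ν * x (n-1) + (1-ν) * x n) * ∑ k ∈ Finset.Icc 1 n, b k * (x k - x (k-1)) := by
  set z := ν * x (n-1) + (1-ν) * x n with hz
  set e : ℕ → ℝ := fun k => (z - x k) ^ 2 with he
  have key : 0 ≤ ∑ k ∈ Finset.Icc 1 n, b k * (e (k-1) - e k) := by
    have e1 : e (n-1) = (1-ν)^2 * (x n - x (n-1))^2 := by simp only [he, hz]; ring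
    have e2 : e n = ν^2 * (x n - x (n-1))^2 := by simp only [he, hz]; ring
    have hd := sq_nonneg (x n - x (n-1))
    obtain ⟨p, rfl⟩ : ∃ p, n = p + 1 := ⟨n-1, by omega⟩
    rcases Nat.eq_zero_or_pos p with rfl | hp
    · simp only [zero_add, Finset.Icc_self, Finset.sum_singleton]
      simp only [zero_add] at e1 e2 hd
      rw [e1, e2]
      apply mul_nonneg hb1
      nlinarith
    · rw [Finset.sum_Icc_succ_top (by omega)]
      have h := aux_abel (p+1) b e hb1 hbm (fun k => sq_nonneg _) p hp (by omega)
      have h2 := hb2 (by omega)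
      rw [e1, e2]
      simp only [Nat.add_sub_cancel] at *
      rw [e1] at h
      have hbp : 0 ≤ b p := by
        have : ∀ q, 1 ≤ q → q ≤ p → 0 ≤ b q := by
          intro q hq
          induction q, hq using Nat.le_induction with
          | base => intro _; exact hb1
          | succ q hq ih => intro h; exact (ih (by omega)).trans (hbm q hq (by omega))
        exact this p hp le_rfl
      have h3 : 0 ≤ (b (p+1) - b p) * (1-ν)^2 - b (p+1) * ν^2 := by
        have : 0 ≤ (1-ν) * ν * b p := mul_nonneg (mul_nonneg (by linarith) hν0) hbp
        nlinarith
      have h4 := mul_nonneg h3 hd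
      nlinarith
  have : 2 * z * ∑ k ∈ Finset.Icc 1 n, b k * (x k - x (k-1)) - ∑ k ∈ Finset.Icc 1 n, b k * (x k ^ 2 - x (k-1) ^ 2)
      = ∑ k ∈ Finset.Icc 1 n, b k * (e (k-1) - e k) := by
    rw [Finset.mul_sum, ← Finset.sum_sub_distrib]
    apply Finset.sum_congr rfl
    intro k _
    simp only [he]; ring
  linarith

lemma aux_parts0 (p w : ℕ → ℝ) (m : ℕ) : ∑ i ∈ Finset.Icc 1 m, (p i - p (i+1)) * w i
    = ∑ i ∈ Finset.Icc 1 m, p i * (w i - w (i-1)) - p (m+1) * w m + p 1 * w 0 := by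
  induction m with
  | zero => simp
  | succ m ih => rw [Finset.sum_Icc_succ_top (by omega), Finset.sum_Icc_succ_top (by omega), ih]
                 simp; ring

lemma aux_parts (hs xl : ℝ) (hhs : 0 < hs) (μ : ℝ → ℝ) (M : ℕ) (hM : 1 ≤ M) (v w : ℕ → ℝ)
    (hw0 : w 0 = 0) (hwM : w M = 0) :
    ∑ i ∈ Finset.Icc 1 (M-1), discLh hs xl μ v i * w i
      = ∑ i ∈ Finset.Icc 1 M, μ (xl + ((i:ℝ) - 1/2) * hs) * ((v i - v (i-1)) / hs) * ((w i - w (i-1)) / hs) := by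
  obtain ⟨m, rfl⟩ : ∃ p, M = p + 1 := ⟨M-1, by omega⟩
  have h := aux_parts0 (fun i => μ (xl + ((i:ℝ) - 1/2) * hs) * ((v i - v (i-1)) / hs) / hs) w m
  simp only [Nat.add_sub_cancel]
  rw [Finset.sum_Icc_succ_top (by omega)]
  have e1 : ∑ i ∈ Finset.Icc 1 m, discLh hs xl μ v i * w i = ∑ i ∈ Finset.Icc 1 m,
      (μ (xl + ((i:ℝ) - 1/2) * hs) * ((v i - v (i-1)) / hs) / hs -
       μ (xl + (((i+1:ℕ):ℝ) - 1/2) * hs) * ((v (i+1) - v (i+1-1)) / hs) / hs) * w i := by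
    apply Finset.sum_congr rfl
    intro i _
    rw [discLh, show (((i+1:ℕ):ℝ) - 1/2) = (i:ℝ) + 1/2 by push_cast; ring]
    simp only [Nat.add_sub_cancel]
    ring
  rw [e1, h, hw0, hwM]
  simp only [Nat.add_sub_cancel]
  have e2 : ∑ i ∈ Finset.Icc 1 m, μ (xl + ((i:ℝ) - 1/2) * hs) * ((v i - v (i-1)) / hs) / hs * (w i - w (i-1))
    = ∑ i ∈ Finset.Icc 1 m, μ (xl + ((i:ℝ) - 1/2) * hs) * ((v i - v (i-1)) / hs) * ((w i - w (i-1)) / hs) := by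
    apply Finset.sum_congr rfl
    intro i _
    ring
  rw [e2]
  ring

lemma aux_step (n : ℕ) (hn : 1 ≤ n) (ν : ℝ) (hν0 : 0 ≤ ν) (hν1 : ν < 1/2) (b : ℕ → ℝ)
    (hb1 : 0 ≤ b 1) (hbm : ∀ k, 1 ≤ k → k + 1 ≤ n → b k ≤ b (k+1))
    (hb2 : 2 ≤ n → 0 ≤ (1-2*ν) * b n - (1-ν) * b (n-1))
    (hs xl : ℝ) (hhs : 0 < hs) (μ : ℝ → ℝ) (M : ℕ) (hM : 1 ≤ M)
    (hμ : ∀ i : ℕ, 1 ≤ i → i ≤ M → 0 ≤ μ (xl + ((i:ℝ) - 1/2) * hs))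
    (c : ℝ → ℝ) (κ : ℝ) (hκ : ∀ i : ℕ, i ≤ M → |c (xl + (i:ℝ) * hs)| ≤ κ)
    (CΩ : ℝ)
    (hCΩ : ∀ v : ℕ → ℝ, v 0 = 0 → v M = 0 → discL2sq hs M v ≤ CΩ * discH1sq hs xl μ M v)
    (hCΩpos : 0 < CΩ)
    (u : ℕ → ℕ → ℝ) (f : ℕ → ℝ)
    (hub : ∀ k : ℕ, k ≤ n → u k 0 = 0 ∧ u k M = 0)
    (hscheme : ∀ i : ℕ, 1 ≤ i → i ≤ M - 1 →
      ∑ k ∈ Finset.Icc 1 n, b k * (u k i - u (k-1) i)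
          + discLh hs xl μ (fun j => ν * u (n-1) j + (1-ν) * u n j) i
        = c (xl + (i:ℝ) * hs) * (ν * u (n-1) i + (1-ν) * u n i) + f i) :
    ∑ k ∈ Finset.Icc 1 n, b k * (discH1sq hs xl μ M (u k) - discH1sq hs xl μ M (u (k-1)))
      ≤ κ^2 * CΩ * (ν * discH1sq hs xl μ M (u (n-1)) + (1-ν) * discH1sq hs xl μ M (u n))
        + discL2sq hs M f := by
  set z : ℕ → ℝ := fun j => ν * u (n-1) j + (1-ν) * u n j with hz
  set d : ℕ → ℝ := fun i => ∑ k ∈ Finset.Icc 1 n, b k * (u k i - u (k-1) i) with hd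
  have hd0 : d 0 = 0 := by
    apply Finset.sum_eq_zero
    intro k hk
    rw [Finset.mem_Icc] at hk
    rw [(hub k hk.2).1, (hub (k-1) (by omega)).1]; ring
  have hdM : d M = 0 := by
    apply Finset.sum_eq_zero
    intro k hk
    rw [Finset.mem_Icc] at hk
    rw [(hub k hk.2).2, (hub (k-1) (by omega)).2]; ring
  have s1 : ∑ k ∈ Finset.Icc 1 n, b k * (discH1sq hs xl μ M (u k) - discH1sq hs xl μ M (u (k-1)))
      = hs * ∑ i ∈ Finset.Icc 1 M, μ (xl + ((i:ℝ) - 1/2) * hs) *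
        ∑ k ∈ Finset.Icc 1 n, b k * (((u k i - u k (i-1)) / hs)^2 - ((u (k-1) i - u (k-1) (i-1)) / hs)^2) := by
    simp only [discH1sq, ← mul_sub, ← Finset.sum_sub_distrib, Finset.mul_sum]
    rw [Finset.sum_comm]
    apply Finset.sum_congr rfl; intro i _
    apply Finset.sum_congr rfl; intro k _
    ring
  have s2 : ∑ i ∈ Finset.Icc 1 M, μ (xl + ((i:ℝ) - 1/2) * hs) *
        ∑ k ∈ Finset.Icc 1 n, b k * (((u k i - u k (i-1)) / hs)^2 - ((u (k-1) i - u (k-1) (i-1)) / hs)^2)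
      ≤ ∑ i ∈ Finset.Icc 1 M, 2 * (μ (xl + ((i:ℝ) - 1/2) * hs) * ((z i - z (i-1)) / hs) * ((d i - d (i-1)) / hs)) := by
    apply Finset.sum_le_sum
    intro i hi
    rw [Finset.mem_Icc] at hi
    have h := aux_energy n hn ν hν0 hν1 b (fun k => (u k i - u k (i-1)) / hs) hb1 hbm hb2
    have h2 := mul_le_mul_of_nonneg_left h (hμ i hi.1 hi.2)
    refine h2.trans (le_of_eq ?_)
    have e1 : ∑ k ∈ Finset.Icc 1 n, b k * ((u k i - u k (i-1)) / hs - (u (k-1) i - u (k-1) (i-1)) / hs)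
        = (d i - d (i-1)) / hs := by
      simp only [hd]
      rw [← Finset.sum_sub_distrib, Finset.sum_div]
      apply Finset.sum_congr rfl; intro k _
      ring
    rw [e1]
    simp only [hz]
    ring
  rw [← Finset.mul_sum, ← aux_parts hs xl hhs μ M hM z d hd0 hdM] at s2
  have s3 : 2 * ∑ i ∈ Finset.Icc 1 (M-1), discLh hs xl μ z i * d i
      ≤ κ^2 * ∑ i ∈ Finset.Icc 1 (M-1), z i ^ 2 + ∑ i ∈ Finset.Icc 1 (M-1), f i ^ 2 := by
    rw [Finset.mul_sum, Finset.mul_sum, ← Finset.sum_add_distrib]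
    apply Finset.sum_le_sum
    intro i hi
    rw [Finset.mem_Icc] at hi
    have h := hscheme i hi.1 hi.2
    have hc := hκ i (by omega)
    have hc2 : c (xl + (i:ℝ) * hs) ^ 2 ≤ κ ^ 2 := by
      rw [← sq_abs]
      exact pow_le_pow_left₀ (abs_nonneg _) hc 2
    change d i + discLh hs xl μ z i = c (xl + (i:ℝ) * hs) * z i + f i at h
    generalize c (xl + (i:ℝ) * hs) = ci at *
    have e : discLh hs xl μ z i = ci * z i + f i - d i := by linarith
    rw [e]
    have h3 := mul_le_mul_of_nonneg_right hc2 (sq_nonneg (z i))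
    nlinarith [sq_nonneg (ci * z i - f i), sq_nonneg (ci * z i + f i - 2 * d i)]
  have hz0 : z 0 = 0 := by simp only [hz]; rw [(hub n le_rfl).1, (hub (n-1) (by omega)).1]; ring
  have hzM : z M = 0 := by simp only [hz]; rw [(hub n le_rfl).2, (hub (n-1) (by omega)).2]; ring
  have s4 := hCΩ z hz0 hzM
  have s5 : discH1sq hs xl μ M z ≤ ν * discH1sq hs xl μ M (u (n-1)) + (1-ν) * discH1sq hs xl μ M (u n) := by
    have : ν * discH1sq hs xl μ M (u (n-1)) + (1-ν) * discH1sq hs xl μ M (u n) = hs * ∑ i ∈ Finset.Icc 1 M,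
        μ (xl + ((i:ℝ) - 1/2) * hs) * (ν * ((u (n-1) i - u (n-1) (i-1)) / hs)^2 + (1-ν) * ((u n i - u n (i-1)) / hs)^2) := by
      simp only [discH1sq, Finset.mul_sum, ← Finset.sum_add_distrib]
      apply Finset.sum_congr rfl; intro i _
      ring
    rw [this, discH1sq]
    apply mul_le_mul_of_nonneg_left _ hhs.le
    apply Finset.sum_le_sum
    intro i hi
    rw [Finset.mem_Icc] at hi
    apply mul_le_mul_of_nonneg_left _ (hμ i hi.1 hi.2)
    have e : (z i - z (i-1)) / hs = ν * ((u (n-1) i - u (n-1) (i-1)) / hs) + (1-ν) * ((u n i - u n (i-1)) / hs) := by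
      simp only [hz]; ring
    rw [e]
    generalize (u (n-1) i - u (n-1) (i-1)) / hs = p
    generalize (u n i - u n (i-1)) / hs = q
    have : 0 ≤ ν * (1-ν) * (p - q)^2 := mul_nonneg (mul_nonneg hν0 (by linarith)) (sq_nonneg _)
    nlinarith
  rw [s1]
  have s6 := mul_le_mul_of_nonneg_left (s2.trans s3) hhs.le
  refine s6.trans ?_
  have s7 := mul_le_mul_of_nonneg_left (s4.trans (mul_le_mul_of_nonneg_left s5 hCΩpos.le)) (sq_nonneg κ)
  simp only [discL2sq] at s7 ⊢
  linarith

lemma aux_gron (n : ℕ) (y W : ℕ → ℝ) (q : ℕ → ℕ → ℝ) (lam G ν : ℝ) (hν0 : 0 ≤ ν) (hν1 : ν < 1/2)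
    (hlam : 0 < lam) (hy : ∀ k, 0 ≤ y k) (hy0 : y 0 ≤ G)
    (hineq : ∀ k, 1 ≤ k → k ≤ n → y k ≤ G + lam * ∑ j ∈ Finset.Icc 1 k, q k j * (ν * y (j-1) + (1-ν) * y j))
    (hq : ∀ k j, 1 ≤ j → j ≤ k → k ≤ n → 0 ≤ q k j)
    (hW : ∀ k, 1 ≤ k → k ≤ n → 4 * lam * ∑ j ∈ Finset.Icc 1 (k-1), q k j * W j ≤ W k - 1)
    (hW1 : ∀ k, 1 ≤ k → k ≤ n → 1 ≤ W k)
    (hWm : ∀ j k, 1 ≤ j → j ≤ k → k ≤ n → W j ≤ W k)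
    (hq0 : ∀ k, 1 ≤ k → k ≤ n → 4 * lam * q k k ≤ 1) :
    ∀ k, 1 ≤ k → k ≤ n → y k ≤ 2 * W k * G := by
  intro k
  induction k using Nat.strong_induction_on with
  | _ k ih =>
    intro hk hkn
    have hG0 : 0 ≤ G := (hy 0).trans hy0
    have hprev : ∀ j, 1 ≤ j → j ≤ k → y (j-1) ≤ 2 * W j * G := by
      intro j hj hjk
      have hWj := hW1 j hj (by omega)
      by_cases h1 : j = 1
      · subst h1
        simp only [Nat.sub_self]
        nlinarith
      · have := ih (j-1) (by omega) (by omega) (by omega)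
        have h2 := hWm (j-1) j (by omega) (by omega) (by omega)
        nlinarith
    rcases le_or_gt (y k) (y (k-1)) with h | h
    · exact h.trans (hprev k hk le_rfl)
    have h1 := hineq k hk hkn
    obtain ⟨p, rfl⟩ : ∃ p, k = p + 1 := ⟨k-1, by omega⟩
    rw [Finset.sum_Icc_succ_top (by omega)] at h1
    simp only [Nat.add_sub_cancel] at *
    have h2 : ∑ j ∈ Finset.Icc 1 p, q (p+1) j * (ν * y (j-1) + (1-ν) * y j) ≤
        2 * G * ∑ j ∈ Finset.Icc 1 p, q (p+1) j * W j := by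
      rw [Finset.mul_sum]
      apply Finset.sum_le_sum
      intro j hj
      rw [Finset.mem_Icc] at hj
      have i1 := hprev j hj.1 (by omega)
      have i2 := ih j (by omega) hj.1 (by omega)
      have i3 := hq (p+1) j hj.1 (by omega) hkn
      have : ν * y (j-1) + (1-ν) * y j ≤ 2 * W j * G := by nlinarith
      nlinarith
    have h3 := hW (p+1) hk hkn
    simp only [Nat.add_sub_cancel] at h3
    have h4 := hq0 (p+1) hk hkn
    have h5 := hq (p+1) (p+1) hk le_rfl hkn
    have h6 := hW1 (p+1) hk hkn
    have h7 : ν * y p + (1-ν) * y (p+1) ≤ y (p+1) := by nlinarith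
    have h8 : lam * (q (p+1) (p+1) * (ν * y p + (1-ν) * y (p+1))) ≤ y (p+1) / 4 := by
      have a1 := mul_le_mul_of_nonneg_left h7 (mul_nonneg hlam.le h5)
      have a2 := mul_le_mul_of_nonneg_right h4 (hy (p+1))
      nlinarith
    have h9 := mul_le_mul_of_nonneg_left h2 hlam.le
    have h10 := mul_le_mul_of_nonneg_left h3 hG0
    have h11 := mul_le_mul_of_nonneg_right h6 hG0
    rw [mul_add] at h1
    generalize ∑ j ∈ Finset.Icc 1 p, q (p+1) j * W j = SW at *
    nlinarith

/-- H¹-norm stability of the weighted time-stepping scheme. -/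
theorem stmt_7 (N : ℕ) (hN : 1 ≤ N) (α ν πA ρ T : ℝ)
    (hα0 : 0 < α) (hα1 : α < 1) (hν0 : 0 ≤ ν) (hν1 : ν < 1/2) (hπA : 0 < πA) (hρ : 0 < ρ)
    (t : ℕ → ℝ) (ht0 : t 0 = 0) (htN : t N = T)
    (htmono : ∀ k : ℕ, 1 ≤ k → k ≤ N → t (k-1) < t k)
    (A P : ℕ → ℕ → ℝ)
    (hA1mono : ∀ n k : ℕ, 2 ≤ k → k ≤ n → n ≤ N → A n (k-1) ≤ A n (k-2) ∧ 0 < A n (k-1))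
    (hA1first : ∀ n : ℕ, 2 ≤ n → n ≤ N → 0 ≤ (1 - 2*ν) * A n 0 - (1-ν) * A n 1)
    (hA1pos : ∀ n : ℕ, 1 ≤ n → n ≤ N → 0 < A n 0)
    (hA2 : ∀ n k : ℕ, 1 ≤ k → k ≤ n → n ≤ N →
      (1 / (πA * (t k - t (k-1)))) *
        ∫ s in (t (k-1))..(t k), (t n - s) ^ (-α) / Real.Gamma (1-α) ≤ A n (n-k))
    (hA3 : ∀ k : ℕ, 1 ≤ k → k ≤ N - 1 → (t k - t (k-1)) / (t (k+1) - t k) ≤ ρ)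
    (hP0 : ∀ n : ℕ, 1 ≤ n → n ≤ N → P n 0 = 1 / A n 0)
    (hPrec : ∀ n j : ℕ, 1 ≤ j → j + 1 ≤ n → n ≤ N →
      P n (n-j) = (1 / A j 0) *
        ∑ k ∈ Finset.Icc (j+1) n, (A k (k-j-1) - A k (k-j)) * P n (n-k))
    (xl xr : ℝ) (hx : xl < xr) (M : ℕ) (hM : 1 ≤ M) (hs : ℝ) (hhs : hs = (xr - xl) / (M:ℝ))
    (μ : ℝ → ℝ) (μ0 μ1 : ℝ) (hμ0 : 0 < μ0)
    (hμ : ∀ x ∈ Set.Icc xl xr, μ0 ≤ μ x ∧ μ x ≤ μ1)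
    (c : ℝ → ℝ) (κ : ℝ) (hκ : ∀ i : ℕ, i ≤ M → |c (xl + (i:ℝ) * hs)| ≤ κ)
    (CΩ : ℝ) (hCΩpos : 0 < CΩ)
    (hCΩ : ∀ v : ℕ → ℝ, v 0 = 0 → v M = 0 → discL2sq hs M v ≤ CΩ * discH1sq hs xl μ M v)
    (u f : ℕ → ℕ → ℝ)
    (hub : ∀ n : ℕ, n ≤ N → u n 0 = 0 ∧ u n M = 0)
    (hscheme : ∀ n i : ℕ, 1 ≤ n → n ≤ N → 1 ≤ i → i ≤ M - 1 →
      ∑ k ∈ Finset.Icc 1 n, A n (n-k) * (u k i - u (k-1) i)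
          + discLh hs xl μ (fun j => ν * u (n-1) j + (1-ν) * u n j) i
        = c (xl + (i:ℝ) * hs) * (ν * u (n-1) i + (1-ν) * u n i) + f n i)
    (τ : ℝ) (hτ : ∀ k : ℕ, 1 ≤ k → k ≤ N → t k - t (k-1) ≤ τ)
    (hτbound : τ ≤ (4 * πA * Real.Gamma (2-α) * κ^2 * CΩ) ^ (-(1:ℝ)/α))
    (n : ℕ) (hn1 : 1 ≤ n) (hnN : n ≤ N) :
    discH1sq hs xl μ M (u n)
      ≤ 2 * (∑' i : ℕ,
            (4 * πA * max 1 ρ * κ^2 * CΩ * t n ^ α) ^ i / Real.Gamma (1 + (i:ℝ) * α)) *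
          (discH1sq hs xl μ M (u 0)
            + (Finset.Icc 1 n).sup' (Finset.nonempty_Icc.mpr hn1)
                (fun k => ∑ j ∈ Finset.Icc 1 k, P k (k-j) * discL2sq hs M (f j))) ∧
    2 * (∑' i : ℕ,
          (4 * πA * max 1 ρ * κ^2 * CΩ * t n ^ α) ^ i / Real.Gamma (1 + (i:ℝ) * α)) *
        (discH1sq hs xl μ M (u 0)
          + (Finset.Icc 1 n).sup' (Finset.nonempty_Icc.mpr hn1)
              (fun k => ∑ j ∈ Finset.Icc 1 k, P k (k-j) * discL2sq hs M (f j)))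
      ≤ 2 * (∑' i : ℕ,
            (4 * πA * max 1 ρ * κ^2 * CΩ * t n ^ α) ^ i / Real.Gamma (1 + (i:ℝ) * α)) *
          (discH1sq hs xl μ M (u 0)
            + πA * Real.Gamma (1-α) *
              (Finset.Icc 1 n).sup' (Finset.nonempty_Icc.mpr hn1)
                (fun k => t k ^ α * discL2sq hs M (f k))) := by
  have hM0 : (0:ℝ) < (M:ℝ) := by exact_mod_cast hM
  have hhs0 : 0 < hs := by rw [hhs]; exact div_pos (by linarith) hM0
  have hhsM : (M:ℝ) * hs = xr - xl := by rw [hhs]; field_simp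
  have hμ' : ∀ i : ℕ, 1 ≤ i → i ≤ M → 0 ≤ μ (xl + ((i:ℝ) - 1/2) * hs) := by
    intro i hi hiM
    have a1 : (1:ℝ) ≤ i := by exact_mod_cast hi
    have a2 : (i:ℝ) ≤ M := by exact_mod_cast hiM
    have := (hμ (xl + ((i:ℝ) - 1/2) * hs) ⟨by nlinarith, by nlinarith⟩).1
    linarith
  have hle : ∀ j k, j ≤ k → k ≤ N → t j ≤ t k := by
    intro j k hjk
    induction k, hjk using Nat.le_induction with
    | base => intro _; exact le_rfl
    | succ k hk ih =>
      intro h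
      have := htmono (k+1) (by omega) h
      simp only [Nat.add_sub_cancel] at this
      exact (ih (by omega)).trans this.le
  have hpos0 : ∀ k, k ≤ N → 0 ≤ t k := fun k hk => ht0 ▸ hle 0 k (by omega) hk
  have hpos : ∀ k, 1 ≤ k → k ≤ N → 0 < t k := by
    intro k hk hkN
    exact lt_of_le_of_lt (hpos0 (k-1) (by omega)) (htmono k hk hkN)
  have hG1 : 0 < Real.Gamma (1-α) := Real.Gamma_pos_of_pos (by linarith)
  have hG2 : 0 < Real.Gamma (2-α) := Real.Gamma_pos_of_pos (by linarith)
  have hG21 : Real.Gamma (2-α) = (1-α) * Real.Gamma (1-α) := by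
    rw [← Real.Gamma_add_one (by linarith)]; congr 1; ring
  have hτ0 : 0 < τ := by
    have a1 := hτ 1 le_rfl hN
    have a2 := htmono 1 le_rfl hN
    linarith
  have hκ0 : κ ≠ 0 := by
    intro h
    rw [h] at hτbound
    have : (4 * πA * Real.Gamma (2-α) * 0^2 * CΩ) = 0 := by ring
    rw [this, Real.zero_rpow (div_ne_zero (by norm_num) hα0.ne')] at hτbound
    linarith
  set lam : ℝ := κ^2 * CΩ with hlam
  have hlam0 : 0 < lam := by positivity
  -- kernel facts
  have hAn : ∀ k j, 1 ≤ j → j ≤ k → k ≤ N → 0 < A k (k-j) := by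
    intro k j hj hjk hk
    by_cases h : j = k
    · subst h; simpa using hA1pos j hj hk
    · have := (hA1mono k (k-j+1) (by omega) (by omega) hk).2
      simpa using this
  have hAm : ∀ k j, 1 ≤ j → j + 1 ≤ k → k ≤ N → A k (k-j) ≤ A k (k-(j+1)) := by
    intro k j hj hjk hk
    have := (hA1mono k (k-j+1) (by omega) (by omega) hk).1
    rw [show k-j+1-1 = k-j by omega, show k-j+1-2 = k-(j+1) by omega] at this
    exact this
  have hqn : ∀ k, 1 ≤ k → k ≤ N → P k (k-k) * A k (k-k) = 1 := by
    intro k hk hkN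
    have := hA1pos k hk hkN
    rw [Nat.sub_self, hP0 k hk hkN]; field_simp
  have hqrec : ∀ k, k ≤ N → ∀ j, 1 ≤ j → j + 1 ≤ k → A j (j-j) * P k (k-j) =
      ∑ l ∈ Finset.Icc (j+1) k, (A l (l-(j+1)) - A l (l-j)) * P k (k-l) := by
    intro k hkN j hj hjk
    have := hA1pos j hj (by omega)
    rw [hPrec k j hj hjk hkN, Nat.sub_self, ← mul_assoc, mul_one_div_cancel this.ne', one_mul]
    apply Finset.sum_congr rfl
    intro l _
    rw [Nat.sub_sub]
  have hid : ∀ l, 1 ≤ l → l ≤ N → ∀ k, 1 ≤ k → k ≤ l → ∑ j ∈ Finset.Icc k l, P l (l-j) * A j (j-k) = 1 := by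
    intro l hl hlN k hk hkl
    exact aux_ident l (fun j k => A j (j-k)) (fun j => P l (l-j)) (hqn l hl hlN) (hqrec l hlN)
      (l-k) k hk (by omega)
  have hqnn : ∀ l j, 1 ≤ j → j ≤ l → l ≤ N → 0 ≤ P l (l-j) := by
    intro l j hj hjl hlN
    exact aux_qnonneg l (fun j k => A j (j-k)) (fun j => P l (l-j)) (hqn l (by omega) hlN)
      (fun j h1 h2 => hAn j j h1 le_rfl (by omega))
      (fun k j h1 h2 h3 => hAm k j h1 h2 (by omega)) (hqrec l hlN) l j hj hjl (by omega)
  -- Mittag-Leffler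
  set W : ℕ → ℝ := fun k => ∑' i : ℕ,
    (4 * πA * max 1 ρ * κ^2 * CΩ * t k ^ α) ^ i / Real.Gamma (1 + (i:ℝ) * α) with hWdef
  have hmax : 0 < max 1 ρ := lt_of_lt_of_le one_pos (le_max_left _ _)
  have hWS : ∀ k, 1 ≤ k → k ≤ N → Summable (fun i : ℕ =>
      (4 * πA * max 1 ρ * κ^2 * CΩ * t k ^ α) ^ i / Real.Gamma (1 + (i:ℝ) * α)) := by
    intro k hk hkN
    have := hpos k hk hkN
    exact aux_ML hα0 hα1 (by positivity)
  have hGi : ∀ i : ℕ, 0 < Real.Gamma (1 + (i:ℝ) * α) := fun i => Real.Gamma_pos_of_pos (by positivity)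
  have hW1 : ∀ k, 1 ≤ k → k ≤ N → 1 ≤ W k := by
    intro k hk hkN
    have hp := hpos k hk hkN
    have := (hWS k hk hkN).le_tsum 0 (fun i _ => by have := hGi i; positivity)
    simpa using this
  have hWm : ∀ j k, 1 ≤ j → j ≤ k → k ≤ N → W j ≤ W k := by
    intro j k hj hjk hk
    have hp := hpos j hj (by omega)
    apply Summable.tsum_le_tsum _ (hWS j hj (by omega)) (hWS k (by omega) hk)
    intro i
    have := hGi i
    have := hle j k hjk hk
    gcongr
  have hWrec : ∀ k, 1 ≤ k → k ≤ N →
      4 * lam * ∑ j ∈ Finset.Icc 1 (k-1), P k (k-j) * W j ≤ W k - 1 := by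
    intro k hk hkN
    have hterm := aux_term α πA ρ hα0 hα1 hπA k hk t ht0 (fun l h1 h2 => htmono l h1 (by omega))
      (fun l h => hpos0 l (by omega)) (fun j l h1 h2 => hle j l h1 (by omega))
      (fun j k => A j (j-k)) (fun j => P k (k-j))
      (fun n' l h1 h2 h3 => hA2 n' l h1 h2 (by omega)) (fun l h1 h2 => hA3 l h1 (by omega))
      (hid k hk hkN) (fun l h1 h2 => hqnn k l h1 h2 hkN) (fun l h1 h2 => (hAn k l h1 h2 hkN).le)
    have := aux_W α πA ρ lam hα0 hα1 hπA hlam0 k hk t (fun l h1 h2 => hpos l h1 (by omega))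
      (fun j => P k (k-j)) hterm
    simp only [hlam, ← mul_assoc] at this
    simp only [hlam, hWdef, ← mul_assoc]
    exact this
  -- time-step restriction
  have hq0 : ∀ k, 1 ≤ k → k ≤ N → 4 * lam * P k (k-k) ≤ 1 := by
    intro k hk hkN
    have hAk := hA1pos k hk hkN
    rw [Nat.sub_self, hP0 k hk hkN, mul_one_div, div_le_one hAk]
    have h := hA2 k k hk le_rfl hkN
    set s := t k - t (k-1) with hs'
    have hs0 : 0 < s := by have := htmono k hk hkN; linarith
    have e : ∫ x in (t (k-1))..(t k), (t k - x) ^ (-α) / Real.Gamma (1-α) = s ^ (1-α) / Real.Gamma (2-α) := by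
      rw [intervalIntegral.integral_div, intervalIntegral.integral_comp_sub_left (fun x => x ^ (-α)),
        integral_rpow (Or.inl (by linarith)), sub_self, show -α + 1 = 1 - α by ring,
        Real.zero_rpow (by linarith), hG21, sub_zero, ← hs', div_div]
    rw [Nat.sub_self, e] at h
    refine le_trans ?_ h
    set K := 4 * πA * Real.Gamma (2-α) * κ^2 * CΩ with hK
    have hK0 : 0 < K := by positivity
    have h2 : s ^ α ≤ K⁻¹ := by
      have := Real.rpow_le_rpow hs0.le ((hτ k hk hkN).trans hτbound) hα0.le
      rw [← Real.rpow_mul hK0.le, div_mul_cancel₀ _ hα0.ne', Real.rpow_neg_one] at this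
      exact this
    have hsα : 0 < s ^ α := by positivity
    have h3 : K * s ^ α ≤ 1 := by
      rw [le_inv_comm₀ hsα hK0] at h2
      calc K * s ^ α ≤ (s ^ α)⁻¹ * s ^ α := by gcongr
        _ = 1 := inv_mul_cancel₀ hsα.ne'
    rw [Real.rpow_sub hs0, Real.rpow_one]
    have e2 : 1 / (πA * s) * (s / s ^ α / Real.Gamma (2-α)) = 1 / (πA * Real.Gamma (2-α) * s ^ α) := by
      field_simp
    rw [e2, le_div_iff₀ (by positivity)]
    calc _ = K * s ^ α := by rw [hK, hlam]; ring
      _ ≤ 1 := h3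
  -- energy inequality
  set y : ℕ → ℝ := fun k => discH1sq hs xl μ M (u k) with hy
  set g : ℕ → ℝ := fun k => discL2sq hs M (f k) with hg
  have hy0 : ∀ k, 0 ≤ y k := by
    intro k
    simp only [hy, discH1sq]
    apply mul_nonneg hhs0.le
    apply Finset.sum_nonneg
    intro i hi
    rw [Finset.mem_Icc] at hi
    exact mul_nonneg (hμ' i hi.1 hi.2) (sq_nonneg _)
  have hg0 : ∀ k, 0 ≤ g k := by
    intro k
    simp only [hg, discL2sq]
    exact mul_nonneg hhs0.le (Finset.sum_nonneg fun i _ => sq_nonneg _)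
  have hstep : ∀ k, 1 ≤ k → k ≤ N → ∑ j ∈ Finset.Icc 1 k, A k (k-j) * (y j - y (j-1)) ≤
      lam * (ν * y (k-1) + (1-ν) * y k) + g k := by
    intro k hk hkN
    refine aux_step k hk ν hν0 hν1 (fun j => A k (k-j)) (hAn k 1 le_rfl hk hkN).le
      (fun j h1 h2 => hAm k j h1 h2 hkN) ?_ hs xl hhs0 μ M hM hμ' c κ hκ CΩ hCΩ hCΩpos u (f k)
      (fun j h => hub j (by omega)) (fun i h1 h2 => hscheme k i hk hkN h1 h2)
    intro h2
    have := hA1first k h2 hkN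
    simp only [Nat.sub_self]
    rw [show k - (k-1) = 1 by omega]
    exact this
  have hyk : ∀ k, 1 ≤ k → k ≤ N → y k ≤ y 0 + ∑ j ∈ Finset.Icc 1 k, P k (k-j) * g j +
      lam * ∑ j ∈ Finset.Icc 1 k, P k (k-j) * (ν * y (j-1) + (1-ν) * y j) := by
    intro k hk hkN
    have h1 := aux_sum k (fun j k => A j (j-k)) (fun j => P k (k-j)) (hid k hk hkN)
      (fun j => y j - y (j-1))
    try simp only at h1
    rw [aux_tel y k] at h1
    have h2 : ∑ j ∈ Finset.Icc 1 k, P k (k-j) * ∑ l ∈ Finset.Icc 1 j, A j (j-l) * (y l - y (l-1)) ≤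
        ∑ j ∈ Finset.Icc 1 k, (P k (k-j) * g j + lam * (P k (k-j) * (ν * y (j-1) + (1-ν) * y j))) := by
      apply Finset.sum_le_sum
      intro j hj
      rw [Finset.mem_Icc] at hj
      have := mul_le_mul_of_nonneg_left (hstep j hj.1 (by omega)) (hqnn k j hj.1 hj.2 hkN)
      linarith
    rw [Finset.sum_add_distrib, ← Finset.mul_sum] at h2
    linarith
  set S := (Finset.Icc 1 n).sup' (Finset.nonempty_Icc.mpr hn1)
    (fun k => ∑ j ∈ Finset.Icc 1 k, P k (k-j) * g j) with hS
  have hSle : ∀ k, 1 ≤ k → k ≤ n → ∑ j ∈ Finset.Icc 1 k, P k (k-j) * g j ≤ S := by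
    intro k hk hkn
    exact Finset.le_sup' (fun k => ∑ j ∈ Finset.Icc 1 k, P k (k-j) * g j) (Finset.mem_Icc.2 ⟨hk, hkn⟩)
  have hS0 : 0 ≤ S := by
    refine le_trans ?_ (hSle n hn1 le_rfl)
    apply Finset.sum_nonneg
    intro j hj
    rw [Finset.mem_Icc] at hj
    exact mul_nonneg (hqnn n j hj.1 hj.2 hnN) (hg0 j)
  constructor
  · refine aux_gron n y W (fun k j => P k (k-j)) lam (y 0 + S) ν hν0 hν1 hlam0 hy0 (by linarith) ?_
      (fun k j h1 h2 h3 => hqnn k j h1 h2 (by omega)) (fun k h1 h2 => hWrec k h1 (by omega))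
      (fun k h1 h2 => hW1 k h1 (by omega)) (fun j k h1 h2 h3 => hWm j k h1 h2 (by omega))
      (fun k h1 h2 => hq0 k h1 (by omega)) n hn1 le_rfl
    intro k hk hkn
    have := hyk k hk (by omega)
    have := hSle k hk hkn
    try simp only
    linarith
  · have hWn := hW1 n hn1 hnN
    apply mul_le_mul_of_nonneg_left _ (by change 0 ≤ 2 * W n; linarith)
    apply add_le_add le_rfl
    set R := (Finset.Icc 1 n).sup' (Finset.nonempty_Icc.mpr hn1) (fun k => t k ^ α * g k) with hR
    have hRle : ∀ k, 1 ≤ k → k ≤ n → t k ^ α * g k ≤ R := by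
      intro k hk hkn
      exact Finset.le_sup' (fun k => t k ^ α * g k) (Finset.mem_Icc.2 ⟨hk, hkn⟩)
    have hR0 : 0 ≤ R := by
      refine le_trans ?_ (hRle n hn1 le_rfl)
      exact mul_nonneg (Real.rpow_nonneg (hpos0 n hnN) _) (hg0 n)
    rw [hS]
    apply Finset.sup'_le
    intro k hk
    rw [Finset.mem_Icc] at hk
    have hA1 : ∀ j, 1 ≤ j → j ≤ N → t j ^ (-α) ≤ πA * Real.Gamma (1-α) * A j (j-1) := by
      intro j hj hjN
      have h := hA2 j 1 le_rfl hj hjN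
      have ht1 := hpos 1 le_rfl hN
      have htj := hpos j hj hjN
      simp only [Nat.sub_self, ht0, sub_zero] at h
      rw [intervalIntegral.integral_div] at h
      have h2 : ∫ x in (0:ℝ)..(t 1), t j ^ (-α) ≤ ∫ x in (0:ℝ)..(t 1), (t j - x) ^ (-α) := by
        apply intervalIntegral.integral_mono_on_of_le_Ioo ht1.le (by simp) (aux_om_int hα1)
        intro x hx
        have := hle 1 j hj hjN
        exact Real.rpow_le_rpow_of_nonpos (by linarith [hx.2]) (by linarith [hx.1]) (by linarith)
      rw [intervalIntegral.integral_const, smul_eq_mul, sub_zero] at h2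
      calc t j ^ (-α) = πA * Real.Gamma (1-α) * (1 / (πA * t 1) * (t 1 * t j ^ (-α) / Real.Gamma (1-α))) := by
            field_simp
        _ ≤ πA * Real.Gamma (1-α) * (1 / (πA * t 1) * ((∫ x in (0:ℝ)..(t 1), (t j - x) ^ (-α)) / Real.Gamma (1-α))) := by
            gcongr
        _ ≤ _ := by gcongr
    calc ∑ j ∈ Finset.Icc 1 k, P k (k-j) * g j
        ≤ ∑ j ∈ Finset.Icc 1 k, (πA * Real.Gamma (1-α) * R) * (P k (k-j) * A j (j-1)) := by
          apply Finset.sum_le_sum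
          intro j hj
          rw [Finset.mem_Icc] at hj
          have htj := hpos j hj.1 (by omega)
          have h1 : g j ≤ R * (πA * Real.Gamma (1-α) * A j (j-1)) := by
            calc g j = (t j ^ α * g j) * t j ^ (-α) := by
                  rw [Real.rpow_neg htj.le]
                  have : 0 < t j ^ α := by positivity
                  field_simp
              _ ≤ R * t j ^ (-α) := by
                  apply mul_le_mul_of_nonneg_right (hRle j hj.1 (by omega)) (by positivity)
              _ ≤ _ := mul_le_mul_of_nonneg_left (hA1 j hj.1 (by omega)) hR0
          have := mul_le_mul_of_nonneg_left h1 (hqnn k j hj.1 hj.2 (by omega))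
          linarith
      _ = πA * Real.Gamma (1-α) * R := by
          rw [← Finset.mul_sum, hid k hk.1 (by omega) 1 le_rfl hk.1, mul_one]
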